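/- Let p ≥ 3 be an odd integer and q the multiplicative order of 2 modulo p. The subgroup H := {f ∈ G : π_p(f(x)) = π_p(x) for every dyadic rational x with 0 < x < 1} of G is isomorphic as a group to the Brown–Thompson group F(2^q), presented with generators x₀, x₁, x₂, … and relations x_i⁻¹·x_j·x_i = x_{j+2^q−1} for all natural numbers i < j. (The p-colorable subgroup F_p of Thompson's group F is isomorphic to the Brown–Thompson group F(2^q).) -/

import Mathlib

/-- The function underlying the generator `f₀` of Thompson's group `F`:
the identity outside `[0,1]`; `2x` on `[0,1/4]`, `x + 1/4` on `[1/4,1/2]`,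
`(x+1)/2` on `[1/2,1]`. -/
noncomputable def f0fun : ℚ → ℚ := fun x =>
  if x < 0 then x
  else if 1 < x then x
  else if x ≤ 1 / 4 then 2 * x
  else if x ≤ 1 / 2 then x + 1 / 4
  else (x + 1) / 2

/-- The function underlying the generator `f₁` of Thompson's group `F`:
the identity outside `[0,1]`; `x` on `[0,1/2]`, `2x − 1/2` on `[1/2,5/8]`,
`x + 1/8` on `[5/8,3/4]`, `(x+1)/2` on `[3/4,1]`. -/
noncomputable def f1fun : ℚ → ℚ := fun x =>
  if x < 0 then x
  else if 1 < x then x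
  else if x ≤ 1 / 2 then x
  else if x ≤ 5 / 8 then 2 * x - 1 / 2
  else if x ≤ 3 / 4 then x + 1 / 8
  else (x + 1) / 2

/-- The realization `G ≤ Equiv.Perm ℚ` of Thompson's group `F`: the subgroup generated
by the permutations whose underlying functions are `f0fun` and `f1fun`. -/
noncomputable def thompsonF : Subgroup (Equiv.Perm ℚ) :=
  Subgroup.closure {g : Equiv.Perm ℚ | ⇑g = f0fun ∨ ⇑g = f1fun}

/-- A rational is dyadic if its (reduced) denominator is a power of two,
equivalently `2^n · x ∈ ℤ` for some `n`. -/
def IsDyadic (x : ℚ) : Prop := ∃ n : ℕ, x.den = 2 ^ n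

/-- `π_p(a / 2^n) = a · (2⁻¹)^n ∈ ZMod p`, computed from the reduced fraction of `x`;
for `p` odd this is the well-defined reduction of a dyadic rational modulo `p`. -/
def piP (p : ℕ) (x : ℚ) : ZMod p :=
  (x.num : ZMod p) * ((2 : ZMod p)⁻¹) ^ (padicValNat 2 x.den)

/-- `D_i = {x ∈ ℚ : 0 < x < 1, x dyadic, π_p(x) = i}`. -/
def DSet (p : ℕ) (i : ZMod p) : Set ℚ :=
  {x : ℚ | 0 < x ∧ x < 1 ∧ IsDyadic x ∧ piP p x = i}

/-- The relations of the infinite presentation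
`⟨x₀, x₁, x₂, … ∣ xᵢ⁻¹ xⱼ xᵢ = x_{j+n−1} (i < j)⟩` of the Brown–Thompson group `F(n)`. -/
def brownThompsonRels (n : ℕ) : Set (FreeGroup ℕ) :=
  {r | ∃ i j : ℕ, i < j ∧
    r = (FreeGroup.of i)⁻¹ * FreeGroup.of j * FreeGroup.of i * (FreeGroup.of (j + n - 1))⁻¹}

/-- `g` maps the closed `n`-adic interval `[a / n ^ m, (a + 1) / n ^ m]` onto
`[b / n ^ l, (b + 1) / n ^ l]` by the increasing affine map. -/
def MapsAdic (n : ℕ) (g : ℚ → ℚ) (a : ℤ) (m : ℕ) (b : ℤ) (l : ℕ) : Prop :=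
  ∀ t : ℚ, 0 ≤ t → t ≤ 1 → g ((a + t) / (n : ℚ) ^ m) = (b + t) / (n : ℚ) ^ l

namespace MapsAdic

variable {n : ℕ} {f g : ℚ → ℚ} {a b c : ℤ} {m l r : ℕ}

lemma comp (hf : MapsAdic n f b l c r) (hg : MapsAdic n g a m b l) :
    MapsAdic n (f ∘ g) a m c r := fun t h0 h1 => by
  rw [Function.comp_apply, hg t h0 h1, hf t h0 h1]

lemma left (hf : MapsAdic n f a m b l) : f (a / (n : ℚ) ^ m) = b / (n : ℚ) ^ l := by
  simpa using hf 0 le_rfl zero_le_one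

lemma right (hf : MapsAdic n f a m b l) :
    f ((a + 1) / (n : ℚ) ^ m) = (b + 1) / (n : ℚ) ^ l :=
  hf 1 zero_le_one le_rfl

lemma refine (hn : 2 ≤ n) (h : MapsAdic n g a m b l) {d : ℕ} {i : ℤ} (h0 : 0 ≤ i)
    (hi : i < (n : ℤ) ^ d) :
    MapsAdic n g (a * n ^ d + i) (m + d) (b * n ^ d + i) (l + d) := fun t ht0 ht1 => by
  have hnd : (0 : ℚ) < (n : ℚ) ^ d := by positivity
  have hnm : (0 : ℚ) < (n : ℚ) ^ m := by positivity
  have hnl : (0 : ℚ) < (n : ℚ) ^ l := by positivity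
  have h0' : (0 : ℚ) ≤ i := by exact_mod_cast h0
  have hi' : (i : ℚ) + 1 ≤ (n : ℚ) ^ d := by exact_mod_cast hi
  have key := h ((i + t) / (n : ℚ) ^ d) (by positivity) (by rw [div_le_one hnd]; linarith)
  have e : ∀ (c : ℤ) (k : ℕ), (((c * n ^ d + i : ℤ) : ℚ) + t) / (n : ℚ) ^ (k + d)
      = (c + (i + t) / (n : ℚ) ^ d) / (n : ℚ) ^ k := fun c k => by
    have hnk : (0 : ℚ) < (n : ℚ) ^ k := by positivity
    push_cast
    field_simp
    ring
  rw [e, e, key]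

lemma exists_refine (hn : 2 ≤ n) (h : ∀ a, ∃ b l, MapsAdic n g a m b l) (d : ℕ) (a : ℤ) :
    ∃ b l, MapsAdic n g a (m + d) b (l + d) := by
  have hnd : (0 : ℤ) < (n : ℤ) ^ d := by positivity
  obtain ⟨b, l, hb⟩ := h (a / n ^ d)
  have := hb.refine hn (Int.emod_nonneg a hnd.ne') (Int.emod_lt_of_pos a hnd)
  rw [mul_comm, Int.mul_ediv_add_emod] at this
  exact ⟨_, l, this⟩

lemma id_of_nonpos (hn : 2 ≤ n) (h : ∀ x ≤ 0, g x = x) (ha : a < 0) :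
    MapsAdic n g a m a m := fun t _ h1 => h _ <| by
  have : (a : ℚ) + 1 ≤ 0 := by exact_mod_cast ha
  exact div_nonpos_of_nonpos_of_nonneg (by linarith) (by positivity)

lemma id_of_one_le (hn : 2 ≤ n) (h : ∀ x, 1 ≤ x → g x = x) (ha : (n : ℤ) ^ m ≤ a) :
    MapsAdic n g a m a m := fun t h0 _ => h _ <| by
  have : (n : ℚ) ^ m ≤ a := by exact_mod_cast ha
  rw [one_le_div (by positivity)]
  linarith

end MapsAdic

/-- A permutation fixing the complement of `(0, 1)` preserves `(-∞, 1)`. -/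
lemma perm_lt_one_iff {f : Equiv.Perm ℚ} (h1 : ∀ x, 1 ≤ x → f x = x) (x : ℚ) :
    f x < 1 ↔ x < 1 := by
  constructor
  · intro h
    by_contra! hx
    rw [h1 x hx] at h
    linarith
  · intro h
    by_contra! hx
    have := f.injective (h1 _ hx)
    linarith

/-- The group of permutations of `ℚ` supported in `(0, 1)` that map each `n`-adic interval of
some fixed level affinely onto an `n`-adic interval. -/
def plGroup (n : ℕ) (hn : 2 ≤ n) : Subgroup (Equiv.Perm ℚ) where
  carrier := {f | (∀ x ≤ 0, f x = x) ∧ (∀ x, 1 ≤ x → f x = x) ∧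
    ∃ N, ∀ a, ∃ b l, MapsAdic n f a N b l}
  one_mem' := ⟨fun _ _ => rfl, fun _ _ => rfl, 0, fun a => ⟨a, 0, fun _ _ _ => rfl⟩⟩
  mul_mem' := by
    rintro f g ⟨f0, f1, M, hM⟩ ⟨g0, g1, N, hN⟩
    refine ⟨fun x hx => ?_, fun x hx => ?_, N + M, fun a => ?_⟩
    · rw [Equiv.Perm.mul_apply, g0 x hx, f0 x hx]
    · rw [Equiv.Perm.mul_apply, g1 x hx, f1 x hx]
    · obtain ⟨b, l, hb⟩ := MapsAdic.exists_refine hn hN M a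
      obtain ⟨c, r, hc⟩ := MapsAdic.exists_refine hn hM l b
      rw [add_comm M l] at hc
      exact ⟨c, r + l, hc.comp hb⟩
  inv_mem' := by
    rintro f ⟨f0, f1, N, hN⟩
    have i0 : ∀ x ≤ 0, f⁻¹ x = x := fun x hx => by rw [Equiv.Perm.inv_eq_iff_eq, f0 x hx]
    have i1 : ∀ x, 1 ≤ x → f⁻¹ x = x := fun x hx => by rw [Equiv.Perm.inv_eq_iff_eq, f1 x hx]
    refine ⟨i0, i1, ?_⟩
    choose b l hb using hN
    refine ⟨∑ a ∈ Finset.Ico (0 : ℤ) (n ^ N), l a, fun c => ?_⟩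
    set M := ∑ a ∈ Finset.Ico (0 : ℤ) (n ^ N), l a with hMdef
    rcases lt_or_ge c 0 with hc | hc
    · exact ⟨c, M, .id_of_nonpos hn i0 hc⟩
    rcases le_or_gt ((n : ℤ) ^ M) c with hc' | hc'
    · exact ⟨c, M, .id_of_one_le hn i1 hc'⟩
    have hnM : (0 : ℚ) < (n : ℚ) ^ M := by positivity
    have hnN : (0 : ℚ) < (n : ℚ) ^ N := by positivity
    obtain ⟨y, hy⟩ := f.surjective (c / (n : ℚ) ^ M)
    have hy0 : 0 ≤ y := by
      by_contra! h
      rw [f0 y h.le] at hy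
      have : (0 : ℚ) ≤ c / (n : ℚ) ^ M := by
        have : (0 : ℚ) ≤ c := by exact_mod_cast hc
        positivity
      linarith
    have hy1 : y < 1 := by
      rw [← perm_lt_one_iff f1, hy, div_lt_one hnM]
      exact_mod_cast hc'
    set a := ⌊y * (n : ℚ) ^ N⌋ with ha
    have hfr0 := Int.fract_nonneg (y * (n : ℚ) ^ N)
    have hfr1 := Int.fract_lt_one (y * (n : ℚ) ^ N)
    set t := Int.fract (y * (n : ℚ) ^ N) with ht
    have hat : (a : ℚ) + t = y * (n : ℚ) ^ N := Int.floor_add_fract _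
    have ha0 : 0 ≤ a := Int.floor_nonneg.2 (by positivity)
    have haN : a < (n : ℤ) ^ N := Int.floor_lt.2 (by push_cast; nlinarith)
    have hle : l a ≤ M := Finset.single_le_sum (f := l) (fun _ _ => Nat.zero_le _)
      (Finset.mem_Ico.2 ⟨ha0, haN⟩)
    obtain ⟨e, he⟩ := Nat.exists_eq_add_of_le hle
    have key := hb a t hfr0 hfr1.le
    rw [hat, mul_div_assoc, div_self hnN.ne', mul_one, hy, he, pow_add] at key
    have hnl : (0 : ℚ) < (n : ℚ) ^ (l a) := by positivity
    have hne : (0 : ℚ) < (n : ℚ) ^ e := by positivity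
    have key2 : (c : ℚ) - b a * (n : ℚ) ^ e = t * (n : ℚ) ^ e := by
      field_simp at key
      linarith
    have hinv : MapsAdic n (f⁻¹ : Equiv.Perm ℚ) (b a) (l a) a N := fun s h0 h1 => by
      rw [Equiv.Perm.inv_eq_iff_eq, hb a s h0 h1]
    have hi0 : (0 : ℤ) ≤ c - b a * n ^ e := by
      have : (0 : ℚ) ≤ ((c - b a * n ^ e : ℤ) : ℚ) := by push_cast; rw [key2]; positivity
      exact_mod_cast this
    have hi1 : c - b a * n ^ e < (n : ℤ) ^ e := by
      have : ((c - b a * n ^ e : ℤ) : ℚ) < (n : ℚ) ^ e := by push_cast; rw [key2]; nlinarith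
      exact_mod_cast this
    have := hinv.refine hn hi0 hi1
    rw [add_sub_cancel, ← he] at this
    exact ⟨_, _, this⟩

/-- The homeomorphism of the line that expands `[j, j + 1]` by the factor `n` and is a
translation on each side of it. -/
def expand (n : ℕ) (hn : 2 ≤ n) (j : ℕ) : Equiv.Perm ℚ where
  toFun x := if x ≤ j then x else if x ≤ j + 1 then n * (x - j) + j else x + (n - 1)
  invFun y := if y ≤ j then y else if y ≤ j + n then (y - j) / n + j else y - (n - 1)
  left_inv x := by
    have hn' : (2 : ℚ) ≤ n := by exact_mod_cast hn
    dsimp only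
    by_cases h1 : x ≤ j
    · simp [h1]
    by_cases h2 : x ≤ j + 1
    · have : ¬ (n * (x - j) + j ≤ (j : ℚ)) := by nlinarith
      have h3 : n * (x - j) + j ≤ (j : ℚ) + n := by nlinarith
      simp only [h1, h2, this, h3, if_true, if_false]
      field_simp
      ring
    · have h3 : ¬ (x + (n - 1) ≤ (j : ℚ)) := by linarith
      have h4 : ¬ (x + (n - 1) ≤ (j : ℚ) + n) := by linarith
      simp only [h1, h2, h3, h4, if_false]
      ring
  right_inv y := by
    have hn' : (2 : ℚ) ≤ n := by exact_mod_cast hn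
    dsimp only
    by_cases h1 : y ≤ j
    · simp [h1]
    by_cases h2 : y ≤ j + n
    · have h3 : ¬ ((y - j) / n + j ≤ (j : ℚ)) := by
        have : 0 < (y - j) / n := div_pos (by linarith) (by linarith)
        linarith
      have h4 : (y - j) / n + j ≤ (j : ℚ) + 1 := by
        have : (y - j) / n ≤ 1 := (div_le_one (by linarith)).2 (by linarith)
        linarith
      simp only [h1, h2, h3, h4, if_true, if_false]
      field_simp
      ring
    · have h3 : ¬ (y - (n - 1) ≤ (j : ℚ)) := by linarith
      have h4 : ¬ (y - (n - 1) ≤ (j : ℚ) + 1) := by linarith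
      simp only [h1, h2, h3, h4, if_false]
      ring

section expand

variable {n : ℕ} {hn : 2 ≤ n} {j : ℕ} {x : ℚ}

lemma expand_of_le (h : x ≤ j) : expand n hn j x = x := if_pos h

lemma expand_of_mem (h : (j : ℚ) ≤ x) (h' : x ≤ j + 1) :
    expand n hn j x = n * (x - j) + j := by
  rcases h.eq_or_lt with h | h
  · rw [expand_of_le h.ge, ← h]; ring
  · exact (if_neg h.not_ge).trans (if_pos h')

lemma expand_of_ge (h : (j : ℚ) + 1 ≤ x) : expand n hn j x = x + (n - 1) := by
  rcases h.eq_or_lt with h | h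
  · rw [expand_of_mem (by linarith) h.ge, ← h]; ring
  · exact (if_neg (by linarith)).trans (if_neg h.not_ge)

lemma le_expand : x ≤ expand n hn j x := by
  have hn' : (2 : ℚ) ≤ n := by exact_mod_cast hn
  rcases le_total x j with h | h
  · rw [expand_of_le h]
  rcases le_total x (j + 1) with h' | h'
  · rw [expand_of_mem h h']; nlinarith
  · rw [expand_of_ge h']; linarith

lemma expand_mul_expand {i : ℕ} (hij : i < j) :
    expand n hn (j + n - 1) * expand n hn i = expand n hn i * expand n hn j := by
  have hn' : (2 : ℚ) ≤ n := by exact_mod_cast hn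
  have hij' : (i : ℚ) + 1 ≤ j := by exact_mod_cast hij
  have hc : ((j + n - 1 : ℕ) : ℚ) = j + n - 1 := by
    rw [Nat.cast_sub (by omega)]; push_cast; ring
  ext x
  simp only [Equiv.Perm.mul_apply]
  rcases le_total x i with h | h
  · rw [expand_of_le h, expand_of_le (j := j + n - 1) (by rw [hc]; linarith),
      expand_of_le (j := j) (by linarith), expand_of_le h]
  rcases le_total x (i + 1) with h' | h'
  · rw [expand_of_mem h h', expand_of_le (by rw [hc]; nlinarith),
      expand_of_le (x := x) (by linarith), expand_of_mem h h']
  rw [expand_of_ge h']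
  rcases le_total x j with h2 | h2
  · rw [expand_of_le (by rw [hc]; linarith), expand_of_le h2, expand_of_ge h']
  rcases le_total x (j + 1) with h3 | h3
  · rw [expand_of_mem (by rw [hc]; linarith) (by rw [hc]; linarith), expand_of_mem h2 h3,
      expand_of_ge (by nlinarith), hc]
    ring
  · rw [expand_of_ge (by rw [hc]; linarith), expand_of_ge h3, expand_of_ge (by linarith)]

/-- `expand n hn j` maps every `n`-adic interval other than `[j, j + 1]` affinely onto an
`n`-adic interval. -/
lemma exists_mapsAdic_expand (b : ℤ) (l : ℕ) (h : ¬ (l = 0 ∧ b = j)) :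
    ∃ c r, MapsAdic n (expand n hn j) b l c r ∧ r ≤ l ∧
      ((j : ℚ) ≤ b / (n : ℚ) ^ l → b / (n : ℚ) ^ l < j + 1 → r < l) := by
  have hn' : (2 : ℚ) ≤ n := by exact_mod_cast hn
  have hnl : (0 : ℚ) < (n : ℚ) ^ l := by positivity
  rcases lt_or_ge b (j * n ^ l) with h1 | h1
  · have h1' : (b : ℚ) + 1 ≤ j * (n : ℚ) ^ l := by exact_mod_cast h1
    refine ⟨b, l, fun t h0 ht => expand_of_le ?_, le_rfl, fun h2 => ?_⟩
    · rw [div_le_iff₀ hnl]; linarith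
    · rw [le_div_iff₀ hnl] at h2
      linarith
  have h1' : (j : ℚ) * (n : ℚ) ^ l ≤ b := by exact_mod_cast h1
  rcases lt_or_ge b ((j + 1) * n ^ l) with h2 | h2
  · have h2' : (b : ℚ) + 1 ≤ (j + 1) * (n : ℚ) ^ l := by exact_mod_cast h2
    obtain ⟨k, rfl⟩ : ∃ k, l = k + 1 := Nat.exists_eq_succ_of_ne_zero <| by
      rintro rfl
      refine h ⟨rfl, ?_⟩
      simp only [pow_zero, mul_one] at h1 h2
      omega
    refine ⟨b - j * (n - 1) * n ^ k, k, fun t h0 ht => ?_, k.le_succ, fun _ _ => k.lt_succ_self⟩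
    have hnk : (0 : ℚ) < (n : ℚ) ^ k := by positivity
    rw [expand_of_mem]
    · push_cast
      rw [pow_succ]
      field_simp
      ring
    · rw [le_div_iff₀ hnl]; linarith
    · rw [div_le_iff₀ hnl]; linarith
  · have h2' : ((j : ℚ) + 1) * (n : ℚ) ^ l ≤ b := by exact_mod_cast h2
    refine ⟨b + (n - 1) * n ^ l, l, fun t h0 ht => ?_, le_rfl, fun _ h3 => ?_⟩
    · rw [expand_of_ge]
      · push_cast
        field_simp
        ring
      · rw [le_div_iff₀ hnl]; linarith
    · rw [div_lt_iff₀ hnl] at h3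
      linarith

end expand

section words

variable {n : ℕ}

/-- The product of the generators of the Brown–Thompson group along a list of indices. -/
def positiveWord (n : ℕ) (L : List ℕ) : PresentedGroup (brownThompsonRels n) :=
  (L.map PresentedGroup.of).prod

lemma positiveWord_cons (i : ℕ) (L : List ℕ) :
    positiveWord n (i :: L) = PresentedGroup.of i * positiveWord n L := by
  simp [positiveWord]

lemma of_mul_of {i j : ℕ} (hij : i < j) :
    (PresentedGroup.of j * PresentedGroup.of i : PresentedGroup (brownThompsonRels n))
      = PresentedGroup.of i * PresentedGroup.of (j + n - 1) := by
  have h : PresentedGroup.mk (brownThompsonRels n) _ = 1 :=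
    PresentedGroup.one_of_mem ⟨i, j, hij, rfl⟩
  simp only [map_mul, map_inv] at h
  change (PresentedGroup.of i)⁻¹ * PresentedGroup.of j * PresentedGroup.of i *
    (PresentedGroup.of (j + n - 1))⁻¹ = (1 : PresentedGroup (brownThompsonRels n)) at h
  rw [mul_inv_eq_one, mul_assoc, inv_mul_eq_iff_eq_mul] at h
  exact h

lemma exists_inv_of_mul_positiveWord (P : List ℕ) (i : ℕ) :
    ∃ P' Q, (PresentedGroup.of i)⁻¹ * positiveWord n P
      = positiveWord n P' * (positiveWord n Q)⁻¹ := by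
  induction P generalizing i with
  | nil => exact ⟨[], [i], by simp [positiveWord]⟩
  | cons j P ih =>
    rcases lt_trichotomy i j with h | rfl | h
    · obtain ⟨P', Q, hP⟩ := ih i
      refine ⟨(j + n - 1) :: P', Q, ?_⟩
      rw [positiveWord_cons, positiveWord_cons, mul_assoc, ← hP, inv_mul_eq_iff_eq_mul,
        ← mul_assoc, ← of_mul_of h]
      group
    · exact ⟨P, [], by simp [positiveWord]⟩
    · obtain ⟨P', Q, hP⟩ := ih (i + n - 1)
      refine ⟨j :: P', Q, ?_⟩
      rw [positiveWord_cons, positiveWord_cons, mul_assoc, ← hP, inv_mul_eq_iff_eq_mul,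
        ← mul_assoc, of_mul_of h]
      group

lemma exists_positiveWord_mul_inv (g : PresentedGroup (brownThompsonRels n)) :
    ∃ P Q, g = positiveWord n P * (positiveWord n Q)⁻¹ := by
  have hg : g ∈ Subgroup.closure (Set.range (PresentedGroup.of (rels := brownThompsonRels n))) := by
    rw [PresentedGroup.closure_range_of]; trivial
  induction hg using Subgroup.closure_induction_left with
  | one => exact ⟨[], [], by simp [positiveWord]⟩
  | mul_left x hx y hy ih =>
    obtain ⟨i, rfl⟩ := hx
    obtain ⟨P, Q, rfl⟩ := ih
    exact ⟨i :: P, Q, by rw [positiveWord_cons, mul_assoc]⟩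
  | inv_mul_cancel x hx y hy ih =>
    obtain ⟨i, rfl⟩ := hx
    obtain ⟨P, Q, rfl⟩ := ih
    obtain ⟨P', R, h⟩ := exists_inv_of_mul_positiveWord (n := n) P i
    refine ⟨P', Q ++ R, ?_⟩
    rw [← mul_assoc, h]
    simp [positiveWord, mul_assoc]

lemma exists_sorted_of_mul_positiveWord (hn : 2 ≤ n) (L : List ℕ) (hL : L.Pairwise (· ≤ ·))
    (j : ℕ) : ∃ L', L'.Pairwise (· ≤ ·) ∧
      PresentedGroup.of j * positiveWord n L = positiveWord n L' ∧
      ∀ c ≤ j, (∀ i ∈ L, c ≤ i) → ∀ i ∈ L', c ≤ i := by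
  induction L generalizing j with
  | nil => exact ⟨[j], by simp, by simp [positiveWord], by simp⟩
  | cons i L ih =>
    rw [List.pairwise_cons] at hL
    rcases le_or_gt j i with h | h
    · refine ⟨j :: i :: L, ?_, (positiveWord_cons _ _).symm, ?_⟩
      · simp only [List.pairwise_cons, List.mem_cons, forall_eq_or_imp]
        exact ⟨⟨h, fun a ha => h.trans (hL.1 a ha)⟩, hL⟩
      · intro c hc hL' a ha
        rcases List.mem_cons.1 ha with rfl | ha
        exacts [hc, hL' a ha]
    · obtain ⟨L', hs, he, hb⟩ := ih hL.2 (j + n - 1)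
      refine ⟨i :: L', ?_, ?_, ?_⟩
      · exact List.pairwise_cons.2 ⟨hb i (by omega) hL.1, hs⟩
      · rw [positiveWord_cons, positiveWord_cons, ← he, ← mul_assoc, ← mul_assoc, of_mul_of h]
      · intro c hc hL' a ha
        simp only [List.mem_cons, forall_eq_or_imp] at hL'
        rcases List.mem_cons.1 ha with rfl | ha
        exacts [hL'.1, hb c (by omega) hL'.2 a ha]

lemma exists_sorted_positiveWord (hn : 2 ≤ n) (P : List ℕ) :
    ∃ L : List ℕ, L.Pairwise (· ≤ ·) ∧ positiveWord n P = positiveWord n L := by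
  induction P with
  | nil => exact ⟨[], by simp, rfl⟩
  | cons j P ih =>
    obtain ⟨L, hL, he⟩ := ih
    obtain ⟨L', hL', he', -⟩ := exists_sorted_of_mul_positiveWord hn L hL j
    exact ⟨L', hL', by rw [positiveWord_cons, he, he']⟩

/-- The action of the Brown–Thompson group on the line, where `x_j` contracts `[j, j + n]` to
`[j, j + 1]`. -/
def lineAction (n : ℕ) (hn : 2 ≤ n) :
    PresentedGroup (brownThompsonRels n) →* Equiv.Perm ℚ :=
  PresentedGroup.toGroup (f := fun j => (expand n hn j)⁻¹) <| by
    rintro _ ⟨i, j, hij, rfl⟩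
    simp only [map_mul, map_inv, FreeGroup.lift_apply_of, inv_inv]
    rw [eq_mul_inv_of_mul_eq (expand_mul_expand (n := n) (hn := hn) hij)]
    group

lemma lineAction_of (hn : 2 ≤ n) (j : ℕ) :
    lineAction n hn (PresentedGroup.of j) = (expand n hn j)⁻¹ :=
  PresentedGroup.toGroup.of _

lemma lineAction_inv_cons (hn : 2 ≤ n) (j : ℕ) (L : List ℕ) (x : ℚ) :
    (lineAction n hn (positiveWord n (j :: L)))⁻¹ x
      = (lineAction n hn (positiveWord n L))⁻¹ (expand n hn j x) := by
  rw [positiveWord_cons, map_mul, lineAction_of, mul_inv_rev, inv_inv, Equiv.Perm.mul_apply]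

lemma le_lineAction_inv (hn : 2 ≤ n) (L : List ℕ) (x : ℚ) :
    x ≤ (lineAction n hn (positiveWord n L))⁻¹ x := by
  induction L generalizing x with
  | nil => simp [positiveWord]
  | cons j L ih =>
    rw [lineAction_inv_cons]
    exact le_expand.trans (ih _)

lemma lineAction_inv_of_le (hn : 2 ≤ n) (L : List ℕ) (x : ℚ) (h : ∀ i ∈ L, x ≤ (i : ℕ)) :
    (lineAction n hn (positiveWord n L))⁻¹ x = x := by
  induction L with
  | nil => simp [positiveWord]
  | cons j L ih =>
    simp only [List.mem_cons, forall_eq_or_imp] at h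
    rw [lineAction_inv_cons, expand_of_le h.1, ih h.2]

lemma lineAction_cons_ne (hn : 2 ≤ n) (i : ℕ) (P Q : List ℕ) (hQ : ∀ j ∈ Q, i < j) :
    lineAction n hn (positiveWord n (i :: P)) ≠ lineAction n hn (positiveWord n Q) := by
  intro h
  have hn' : (2 : ℚ) ≤ n := by exact_mod_cast hn
  have h1 := lineAction_inv_of_le hn Q (i + 1) fun j hj => by exact_mod_cast hQ j hj
  rw [← h, lineAction_inv_cons, expand_of_ge le_rfl] at h1
  have h2 := le_lineAction_inv hn P (i + 1 + (n - 1))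
  linarith

lemma sorted_lineAction_injective (hn : 2 ≤ n) (P Q : List ℕ) (hP : P.Pairwise (· ≤ ·))
    (hQ : Q.Pairwise (· ≤ ·))
    (h : lineAction n hn (positiveWord n P) = lineAction n hn (positiveWord n Q)) : P = Q := by
  induction P generalizing Q with
  | nil =>
    cases Q with
    | nil => rfl
    | cons j Q => exact absurd h.symm (lineAction_cons_ne hn j Q [] (by simp))
  | cons i P ih =>
    cases Q with
    | nil => exact absurd h (lineAction_cons_ne hn i P [] (by simp))
    | cons j Q =>
      have hlt : ∀ {a b : ℕ} {L : List ℕ}, (b :: L).Pairwise (· ≤ ·) → a < b →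
          ∀ k ∈ b :: L, a < k := fun hs hab k hk => by
        rcases List.mem_cons.1 hk with rfl | hk
        exacts [hab, hab.trans_le ((List.pairwise_cons.1 hs).1 k hk)]
      rcases lt_trichotomy i j with hij | rfl | hij
      · exact absurd h (lineAction_cons_ne hn i P _ (hlt hQ hij))
      · rw [positiveWord_cons, positiveWord_cons, map_mul, map_mul, mul_right_inj] at h
        rw [ih Q (List.pairwise_cons.1 hP).2 (List.pairwise_cons.1 hQ).2 h]
      · exact absurd h.symm (lineAction_cons_ne hn j Q _ (hlt hP hij))

lemma lineAction_injective (hn : 2 ≤ n) : Function.Injective (lineAction n hn) := by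
  rw [injective_iff_map_eq_one]
  intro g hg
  obtain ⟨P, Q, rfl⟩ := exists_positiveWord_mul_inv g
  obtain ⟨P', hP', eP⟩ := exists_sorted_positiveWord hn P
  obtain ⟨Q', hQ', eQ⟩ := exists_sorted_positiveWord hn Q
  rw [eP, eQ, map_mul, map_inv, mul_inv_eq_one] at hg
  rw [eP, eQ, sorted_lineAction_injective hn P' Q' hP' hQ' hg, mul_inv_cancel]

end words

/-- The piecewise affine homeomorphism from the line onto `(-∞, 1)` that is the identity on
negative numbers and maps `[(n - 1) * M, (n - 1) * (M + 1)]` affinely onto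
`[1 - 1 / n ^ M, 1 - 1 / n ^ (M + 1)]`. -/
def chart (n : ℕ) (x : ℚ) : ℚ :=
  if x < 0 then x else
    1 - 1 / (n : ℚ) ^ ⌊x / (n - 1)⌋₊ +
      (x - (n - 1) * ⌊x / (n - 1)⌋₊) / (n : ℚ) ^ (⌊x / (n - 1)⌋₊ + 1)

section chart

variable {n : ℕ} {x : ℚ}

lemma exists_block (hn : 2 ≤ n) (hx : 0 ≤ x) :
    ∃ M : ℕ, (n - 1 : ℚ) * M ≤ x ∧ x < (n - 1) * (M + 1) ∧ ⌊x / (n - 1)⌋₊ = M := by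
  have hn' : (0 : ℚ) < n - 1 := by
    have : (2 : ℚ) ≤ n := by exact_mod_cast hn
    linarith
  refine ⟨⌊x / (n - 1)⌋₊, ?_, ?_, rfl⟩
  · rw [← le_div_iff₀' hn']
    exact Nat.floor_le (by positivity)
  · rw [← div_lt_iff₀' hn']
    exact Nat.lt_floor_add_one _

lemma chart_eq (hn : 2 ≤ n) {M : ℕ} (h : (n - 1 : ℚ) * M ≤ x) (h' : x ≤ (n - 1) * (M + 1)) :
    chart n x = 1 - 1 / (n : ℚ) ^ M + (x - (n - 1) * M) / (n : ℚ) ^ (M + 1) := by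
  have hn2 : (2 : ℚ) ≤ n := by exact_mod_cast hn
  have hn' : (0 : ℚ) < n - 1 := by linarith
  have hx : 0 ≤ x := le_trans (by positivity) h
  have hM : (0 : ℚ) < (n : ℚ) ^ M := by positivity
  rcases h'.lt_or_eq with h' | h'
  · have : ⌊x / (n - 1 : ℚ)⌋₊ = M := by
      rw [Nat.floor_eq_iff (by positivity), le_div_iff₀' hn', div_lt_iff₀' hn']
      exact ⟨h, h'⟩
    rw [chart, if_neg hx.not_gt, this]
  · have : ⌊x / (n - 1 : ℚ)⌋₊ = M + 1 := by
      rw [h', mul_div_cancel_left₀ _ hn'.ne']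
      exact_mod_cast Nat.floor_natCast (M + 1)
    rw [chart, if_neg hx.not_gt, this, h', pow_succ, pow_succ]
    push_cast
    field_simp
    ring

lemma chart_of_nonpos (h : x ≤ 0) : chart n x = x := by
  rcases h.lt_or_eq with h | rfl
  · exact if_pos h
  · simp [chart]

lemma chart_mem_block (hn : 2 ≤ n) {M : ℕ} (h : (n - 1 : ℚ) * M ≤ x)
    (h' : x < (n - 1) * (M + 1)) :
    1 - 1 / (n : ℚ) ^ M ≤ chart n x ∧ chart n x < 1 - 1 / (n : ℚ) ^ (M + 1) := by
  have hn2 : (2 : ℚ) ≤ n := by exact_mod_cast hn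
  have hM : (0 : ℚ) < (n : ℚ) ^ (M + 1) := by positivity
  have hM' : (1 : ℚ) / (n : ℚ) ^ M = n / (n : ℚ) ^ (M + 1) := by rw [pow_succ]; field_simp
  rw [chart_eq hn h h'.le]
  constructor
  · have : 0 ≤ (x - (n - 1) * M) / (n : ℚ) ^ (M + 1) := div_nonneg (by linarith) hM.le
    linarith
  · have : (x - (n - 1) * M) / (n : ℚ) ^ (M + 1) < (n - 1) / (n : ℚ) ^ (M + 1) :=
      div_lt_div_of_pos_right (by linarith) hM
    rw [hM']
    rw [sub_div (n : ℚ) 1] at this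
    linarith

lemma one_div_pow_le_one_div_pow' (hn : 2 ≤ n) {M N : ℕ} (h : M ≤ N) :
    1 / (n : ℚ) ^ N ≤ 1 / (n : ℚ) ^ M :=
  one_div_pow_le_one_div_pow_of_le (by exact_mod_cast (by omega : 1 ≤ n)) h

lemma chart_nonneg (hn : 2 ≤ n) (hx : 0 ≤ x) : 0 ≤ chart n x := by
  obtain ⟨M, h, h', -⟩ := exists_block hn hx
  have := one_div_pow_le_one_div_pow' hn (Nat.zero_le M)
  rw [pow_zero, div_one] at this
  linarith [(chart_mem_block hn h h').1]

lemma chart_lt_one (hn : 2 ≤ n) : chart n x < 1 := by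
  rcases lt_or_ge x 0 with hx | hx
  · rw [chart_of_nonpos hx.le]; linarith
  obtain ⟨M, h, h', -⟩ := exists_block hn hx
  have : (0 : ℚ) < 1 / (n : ℚ) ^ (M + 1) := by positivity
  linarith [(chart_mem_block hn h h').2]

lemma chart_strictMono (hn : 2 ≤ n) : StrictMono (chart n) := fun x y hxy => by
  have hn2 : (2 : ℚ) ≤ n := by exact_mod_cast hn
  rcases lt_or_ge x 0 with hx | hx
  · rw [chart_of_nonpos hx.le]
    rcases lt_or_ge y 0 with hy | hy
    · rwa [chart_of_nonpos hy.le]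
    · exact hx.trans_le (chart_nonneg hn hy)
  obtain ⟨M, hM, hM', -⟩ := exists_block hn hx
  obtain ⟨N, hN, hN', -⟩ := exists_block hn (hx.trans hxy.le)
  rcases lt_trichotomy M N with h | rfl | h
  · have := one_div_pow_le_one_div_pow' hn (show M + 1 ≤ N from h)
    linarith [(chart_mem_block hn hM hM').2, (chart_mem_block hn hN hN').1]
  · rw [chart_eq hn hM hM'.le, chart_eq hn hN hN'.le]
    gcongr
  · have : (N : ℚ) + 1 ≤ M := by exact_mod_cast h
    nlinarith

lemma exists_chart_eq (hn : 2 ≤ n) {y : ℚ} (hy : y < 1) : ∃ x, chart n x = y := by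
  rcases lt_or_ge y 0 with h | h
  · exact ⟨y, chart_of_nonpos h.le⟩
  have hn2 : (2 : ℚ) ≤ n := by exact_mod_cast hn
  obtain ⟨M, h1, h2⟩ := exists_nat_pow_near_of_lt_one (x := 1 - y) (y := (1 / n : ℚ))
    (by linarith) (by linarith) (by positivity) (by rw [div_lt_one (by linarith)]; linarith)
  rw [one_div_pow] at h1 h2
  have hM : (0 : ℚ) < (n : ℚ) ^ M := by positivity
  have hM1 : (0 : ℚ) < (n : ℚ) ^ (M + 1) := by positivity
  have e : 1 / (n : ℚ) ^ M * (n : ℚ) ^ (M + 1) = n := by rw [pow_succ]; field_simp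
  rw [div_lt_iff₀ hM1] at h1
  have h3 : 0 ≤ (y - 1 + 1 / (n : ℚ) ^ M) * (n : ℚ) ^ (M + 1) :=
    mul_nonneg (by linarith) hM1.le
  refine ⟨(n - 1) * M + (y - 1 + 1 / (n : ℚ) ^ M) * (n : ℚ) ^ (M + 1), ?_⟩
  rw [chart_eq (M := M) hn (by linarith) (by rw [add_mul, e]; linarith)]
  field_simp
  ring

lemma chart_add (hn : 2 ≤ n) (hx : 0 ≤ x) (r : ℕ) :
    chart n (x + (n - 1) * r) = 1 - (1 - chart n x) / (n : ℚ) ^ r := by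
  have hn2 : (2 : ℚ) ≤ n := by exact_mod_cast hn
  obtain ⟨M, h, h', -⟩ := exists_block hn hx
  rw [chart_eq hn h h'.le, chart_eq (M := M + r) hn (by push_cast; linarith)
    (by push_cast; linarith)]
  rw [show M + r + 1 = (M + 1) + r by ring, pow_add, pow_add, pow_succ]
  push_cast
  field_simp
  ring

lemma mapsAdic_chart_of_block (hn : 2 ≤ n) {b : ℤ} {l M : ℕ} (h : (n - 1 : ℤ) * M * n ^ l ≤ b)
    (h' : b < (n - 1) * (M + 1) * n ^ l) :
    MapsAdic n (chart n) b l (b + n ^ l * (n ^ (M + 1) - n - (n - 1) * M)) (l + (M + 1)) :=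
  fun t h0 h1 => by
    have hl : (0 : ℚ) < (n : ℚ) ^ l := by positivity
    have hM : (0 : ℚ) < (n : ℚ) ^ M := by positivity
    have hb : (n - 1 : ℚ) * M * (n : ℚ) ^ l ≤ b := by exact_mod_cast h
    have hb' : (b : ℚ) + 1 ≤ (n - 1) * (M + 1) * (n : ℚ) ^ l := by exact_mod_cast h'
    rw [chart_eq (M := M) hn (by rw [le_div_iff₀ hl]; linarith)
      (by rw [div_le_iff₀ hl]; linarith)]
    push_cast
    rw [pow_add, pow_succ]
    field_simp
    ring

lemma exists_mapsAdic_chart (hn : 2 ≤ n) {b : ℤ} (hb : 0 ≤ b) (l : ℕ) :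
    ∃ c r, MapsAdic n (chart n) b l c r := by
  have hl : (0 : ℚ) < (n : ℚ) ^ l := by positivity
  obtain ⟨M, h, h', -⟩ := exists_block hn (x := b / (n : ℚ) ^ l)
    (div_nonneg (by exact_mod_cast hb) hl.le)
  rw [le_div_iff₀ hl] at h
  rw [div_lt_iff₀ hl] at h'
  exact ⟨_, _, mapsAdic_chart_of_block (M := M) hn (by exact_mod_cast h) (by exact_mod_cast h')⟩

/-- Every `n`-adic subinterval of `[0, 1)` bounded away from `1` is the image under the chart of
an `n`-adic interval; if it has level at least `i + 2`, that interval is not `[i, i + 1]`. -/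
lemma exists_chart_mapsAdic (hn : 2 ≤ n) {a : ℤ} {N : ℕ} (h0 : 0 ≤ a) (h1 : a + 1 < (n : ℤ) ^ N) :
    ∃ b l, 0 ≤ b ∧ MapsAdic n (chart n) b l a N ∧
      ∀ i : ℕ, i + 2 ≤ N → ¬ (l = 0 ∧ b = i) := by
  have hn2 : (2 : ℚ) ≤ n := by exact_mod_cast hn
  have hN : (0 : ℚ) < (n : ℚ) ^ N := by positivity
  have h0' : (0 : ℚ) ≤ a := by exact_mod_cast h0
  have h1' : (a : ℚ) + 1 < (n : ℚ) ^ N := by exact_mod_cast h1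
  obtain ⟨x, hx⟩ := exists_chart_eq hn (y := a / (n : ℚ) ^ N)
    (by rw [div_lt_one hN]; linarith)
  have hx0 : 0 ≤ x := by
    by_contra! h
    rw [chart_of_nonpos h.le] at hx
    have : 0 ≤ a / (n : ℚ) ^ N := by positivity
    linarith
  obtain ⟨M, h, h', -⟩ := exists_block hn hx0
  have hlt : M < N := by
    by_contra! hle
    have h2 := (chart_mem_block hn h h').1
    have h3 := one_div_pow_le_one_div_pow' hn hle
    have h4 : a / (n : ℚ) ^ N < 1 - 1 / (n : ℚ) ^ N := by
      rw [div_lt_iff₀ hN, sub_mul, one_div, inv_mul_cancel₀ hN.ne']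
      linarith
    linarith
  obtain ⟨l, rfl⟩ : ∃ l, N = l + (M + 1) := ⟨N - (M + 1), by omega⟩
  have hl : (0 : ℚ) < (n : ℚ) ^ l := by positivity
  have hM : (0 : ℚ) < (n : ℚ) ^ M := by positivity
  set b : ℤ := a - n ^ l * (n ^ (M + 1) - n - (n - 1) * M) with hb
  have hbx : (b : ℚ) = x * (n : ℚ) ^ l := by
    rw [chart_eq hn h h'.le, pow_add, pow_succ] at hx
    rw [hb]
    push_cast
    rw [pow_succ]
    field_simp at hx
    have hnp : (0 : ℚ) < n := by linarith
    refine mul_left_cancel₀ (show (n : ℚ) ^ M * n ≠ 0 by positivity) ?_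
    linear_combination -hx
  have hbl : (n - 1 : ℤ) * M * n ^ l ≤ b := by
    have : (n - 1 : ℚ) * M * (n : ℚ) ^ l ≤ b := by rw [hbx]; gcongr
    exact_mod_cast this
  have hbr : b < (n - 1 : ℤ) * (M + 1) * n ^ l := by
    have : b < (n - 1 : ℚ) * (M + 1) * (n : ℚ) ^ l := by rw [hbx]; gcongr
    exact_mod_cast this
  refine ⟨b, l, ?_, ?_, ?_⟩
  · have : (0 : ℚ) ≤ b := by rw [hbx]; positivity
    exact_mod_cast this
  · have := mapsAdic_chart_of_block hn hbl hbr
    rwa [hb, sub_add_cancel, ← hb] at this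
  · rintro i hi ⟨rfl, hbi⟩
    rw [hbi, pow_zero, mul_one] at hbl
    have h5 : (i : ℤ) + 1 ≤ M := by exact_mod_cast (by omega : i + 1 ≤ M)
    have h6 : (2 : ℤ) ≤ n := by exact_mod_cast hn
    nlinarith

/-- The chart as an equivalence onto `(-∞, 1)`. -/
noncomputable def chartEquiv (n : ℕ) (hn : 2 ≤ n) : ℚ ≃ {y : ℚ // y < 1} :=
  Equiv.ofBijective (fun x => ⟨chart n x, chart_lt_one hn⟩)
    ⟨fun _ _ h => (chart_strictMono hn).injective (congrArg Subtype.val h),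
      fun y => (exists_chart_eq hn y.2).imp fun _ h => Subtype.ext h⟩

/-- Conjugation by the chart, extended by the identity on `[1, ∞)`. -/
noncomputable def chartHom (n : ℕ) (hn : 2 ≤ n) : Equiv.Perm ℚ →* Equiv.Perm ℚ :=
  Equiv.Perm.extendDomainHom (chartEquiv n hn)

lemma chartHom_apply_chart (hn : 2 ≤ n) (g : Equiv.Perm ℚ) (x : ℚ) :
    chartHom n hn g (chart n x) = chart n (g x) :=
  Equiv.Perm.extendDomain_apply_image g (chartEquiv n hn) x

lemma chartHom_apply_of_one_le (hn : 2 ≤ n) (g : Equiv.Perm ℚ) (hx : 1 ≤ x) :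
    chartHom n hn g x = x :=
  Equiv.Perm.extendDomain_apply_not_subtype g (chartEquiv n hn) hx.not_gt

lemma exists_chartHom_eq (hn : 2 ≤ n) {f : Equiv.Perm ℚ} (hf : ∀ x, 1 ≤ x → f x = x) :
    ∃ g, chartHom n hn g = f := by
  refine ⟨((chartEquiv n hn).trans (f.subtypePerm (perm_lt_one_iff hf))).trans
    (chartEquiv n hn).symm, Equiv.ext fun y => ?_⟩
  rcases lt_or_ge y 1 with hy | hy
  · obtain ⟨x, rfl⟩ := exists_chart_eq hn hy
    rw [chartHom_apply_chart]
    exact congrArg Subtype.val ((chartEquiv n hn).apply_symm_apply _)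
  · rw [chartHom_apply_of_one_le hn _ hy, hf y hy]

lemma chartHom_expand_mem (hn : 2 ≤ n) (i : ℕ) :
    chartHom n hn (expand n hn i) ∈ plGroup n hn := by
  have hn2 : (2 : ℚ) ≤ n := by exact_mod_cast hn
  have hid0 : ∀ x ≤ 0, chartHom n hn (expand n hn i) x = x := fun x hx => by
    rw [← chart_of_nonpos (n := n) hx, chartHom_apply_chart,
      expand_of_le (hx.trans (by positivity))]
  have hid1 : ∀ x, 1 ≤ x → chartHom n hn (expand n hn i) x = x := fun x hx =>
    chartHom_apply_of_one_le hn _ hx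
  refine ⟨hid0, hid1, i + 2, fun a => ?_⟩
  rcases lt_or_ge a 0 with ha | ha
  · exact ⟨a, _, .id_of_nonpos hn hid0 ha⟩
  rcases lt_trichotomy (a + 1) ((n : ℤ) ^ (i + 2)) with ha' | ha' | ha'
  · obtain ⟨b, l, hb, hbl, hne⟩ := exists_chart_mapsAdic hn ha ha'
    obtain ⟨c, r, hc, -⟩ := exists_mapsAdic_expand (hn := hn) b l (hne i le_rfl)
    have hc0 : 0 ≤ c := by
      have h1 := hc.left
      have h2 : (0 : ℚ) ≤ b / (n : ℚ) ^ l := div_nonneg (by exact_mod_cast hb) (by positivity)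
      have h3 : (0 : ℚ) ≤ c / (n : ℚ) ^ r := h1 ▸ h2.trans le_expand
      rw [le_div_iff₀ (by positivity), zero_mul] at h3
      exact_mod_cast h3
    obtain ⟨d, s, hd⟩ := exists_mapsAdic_chart hn hc0 r
    refine ⟨d, s, fun t h0 h1 => ?_⟩
    rw [← hbl t h0 h1, chartHom_apply_chart, hc t h0 h1, hd t h0 h1]
  · refine ⟨n ^ (i + 3) - 1, i + 3, fun t h0 h1 => ?_⟩
    have ha2 : (a : ℚ) = (n : ℚ) ^ (i + 2) - 1 := by
      rw [eq_sub_iff_add_eq]; exact_mod_cast ha'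
    have hN : (0 : ℚ) < (n : ℚ) ^ (i + 2) := by positivity
    have hN3 : (n : ℚ) ^ (i + 3) = (n : ℚ) ^ (i + 2) * n := pow_succ _ _
    push_cast
    rcases h1.lt_or_eq with h1 | rfl
    · obtain ⟨x, hx⟩ := exists_chart_eq hn (y := t) h1
      have hx0 : 0 ≤ x := by
        by_contra! h
        rw [chart_of_nonpos h.le] at hx
        linarith
      have e : (a + t) / (n : ℚ) ^ (i + 2) = chart n (x + (n - 1) * (i + 2 : ℕ)) := by
        rw [chart_add hn hx0, hx, ha2]
        field_simp
        ring
      rw [e, chartHom_apply_chart, expand_of_ge (by push_cast; nlinarith),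
        show x + (n - 1 : ℚ) * (i + 2 : ℕ) + (n - 1) = x + (n - 1) * (i + 3 : ℕ) by
          push_cast; ring,
        chart_add hn hx0, hx]
      field_simp
      ring
    · rw [ha2, sub_add_cancel, sub_add_cancel, div_self (by positivity), div_self (by positivity),
        hid1 1 le_rfl]
  · exact ⟨a, _, .id_of_one_le hn hid1 (by omega)⟩

end chart

section thompson

lemma coe_chartHom_expand_zero : ⇑(chartHom 2 le_rfl (expand 2 le_rfl 0)) = f0fun := by
  funext y
  rcases le_or_gt 1 y with hy | hy
  · rw [chartHom_apply_of_one_le _ _ hy, f0fun]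
    split_ifs <;> linarith
  obtain ⟨x, rfl⟩ := exists_chart_eq le_rfl hy
  rw [chartHom_apply_chart]
  rcases le_or_gt x 0 with hx | hx
  · rw [expand_of_le (by simpa using hx), chart_of_nonpos hx, f0fun]
    split_ifs <;> linarith
  rcases le_or_gt x 1 with hx1 | hx1
  · rw [expand_of_mem (by simpa using hx.le) (by simpa using hx1),
      chart_eq (x := x) (M := 0) le_rfl (by norm_num; linarith) (by norm_num; linarith)]
    rcases le_or_gt x (1 / 2) with hx2 | hx2
    · rw [chart_eq (M := 0) le_rfl (by norm_num; linarith) (by norm_num; linarith), f0fun]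
      norm_num
      split_ifs <;> linarith
    · rw [chart_eq (M := 1) le_rfl (by norm_num; linarith) (by norm_num; linarith), f0fun]
      norm_num
      split_ifs <;> linarith
  · have h1 := chart_strictMono (le_refl 2) hx1
    rw [chart_eq (x := 1) (M := 0) le_rfl (by norm_num) (by norm_num)] at h1
    norm_num at h1
    have h2 := chart_add (le_refl 2) hx.le 1
    rw [expand_of_ge (by simpa using hx1.le)]
    norm_num at h2 ⊢
    rw [h2, f0fun]
    split_ifs <;> linarith

lemma coe_chartHom_expand_one : ⇑(chartHom 2 le_rfl (expand 2 le_rfl 1)) = f1fun := by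
  funext y
  rcases le_or_gt 1 y with hy | hy
  · rw [chartHom_apply_of_one_le _ _ hy, f1fun]
    split_ifs <;> linarith
  obtain ⟨x, rfl⟩ := exists_chart_eq le_rfl hy
  rw [chartHom_apply_chart]
  rcases le_or_gt x 1 with hx | hx
  · have h1 := (chart_strictMono (le_refl 2)).monotone hx
    rw [chart_eq (x := 1) (M := 0) le_rfl (by norm_num) (by norm_num)] at h1
    norm_num at h1
    rw [expand_of_le (by simpa using hx), f1fun]
    split_ifs <;> linarith
  rcases le_or_gt x 2 with hx1 | hx1
  · rw [expand_of_mem (by simpa using hx.le) (by norm_num; linarith),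
      chart_eq (x := x) (M := 1) le_rfl (by norm_num; linarith) (by norm_num; linarith)]
    rcases le_or_gt x (3 / 2) with hx2 | hx2
    · rw [chart_eq (M := 1) le_rfl (by norm_num; linarith) (by norm_num; linarith), f1fun]
      norm_num
      split_ifs <;> linarith
    · rw [chart_eq (M := 2) le_rfl (by norm_num; linarith) (by norm_num; linarith), f1fun]
      norm_num
      split_ifs <;> linarith
  · have h1 := chart_strictMono (le_refl 2) hx1
    rw [chart_eq (x := 2) (M := 1) le_rfl (by norm_num) (by norm_num)] at h1
    norm_num at h1
    have h2 := chart_add (le_refl 2) (x := x) (by linarith) 1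
    rw [expand_of_ge (by norm_num; linarith)]
    norm_num at h2 ⊢
    rw [h2, f1fun]
    split_ifs <;> linarith

end thompson

section generation

variable {n : ℕ}

/-- An injective map of the line that maps unit intervals affinely onto `n`-adic intervals, almost
all of them unit intervals, is inverse to an element of the group generated by the expansions. -/
lemma exists_mem_closure_expand_comp_eq (hn : 2 ≤ n) (s : Finset ℤ) {A : ℚ → ℚ}
    (hA : Function.Injective A) (h0 : ∀ x ≤ 0, A x = x) {b : ℤ → ℤ} {l : ℤ → ℕ}
    (h : ∀ k, MapsAdic n A k 0 (b k) (l k)) (hs : ∀ k ∉ s, l k = 0) :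
    ∃ γ ∈ Subgroup.closure (Set.range (expand n hn)), ∀ x, γ (A x) = x := by
  induction hS : ∑ k ∈ s, l k using Nat.strong_induction_on generalizing A b l with
  | _ S ih =>
  have hl : ∀ k : ℤ, A k = b k / (n : ℚ) ^ l k := fun k => by simpa using (h k).left
  have hr : ∀ k : ℤ, A (k + 1) = (b k + 1) / (n : ℚ) ^ l k := fun k => by simpa using (h k).right
  by_cases hz : ∀ k, l k = 0
  · refine ⟨1, one_mem _, fun x => ?_⟩
    simp only [hz, pow_zero, div_one] at hl hr
    have hb : ∀ k : ℤ, A k = k := fun k => by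
      rcases le_total k 0 with hk | hk
      · exact h0 _ (by exact_mod_cast hk)
      · induction k, hk using Int.leInduction with
        | base => exact h0 _ (by simp)
        | succ k _ hk => rw [Int.cast_add, Int.cast_one, hr, ← hl, hk]
    have := h ⌊x⌋ (Int.fract x) (Int.fract_nonneg x) (Int.fract_lt_one x).le
    rwa [hz, pow_zero, div_one, div_one, Int.floor_add_fract, ← hl, hb, Int.floor_add_fract]
      at this
  push Not at hz
  obtain ⟨k₀, hk₀⟩ := hz
  have hk0 : 0 ≤ k₀ := by
    by_contra! hneg
    have hneg' : (k₀ : ℚ) + 1 ≤ 0 := by exact_mod_cast hneg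
    have e1 := hl k₀
    have e2 := hr k₀
    rw [h0 _ (by linarith)] at e1
    rw [h0 _ hneg', add_div, ← e1, add_right_inj, eq_div_iff (by positivity), one_mul] at e2
    have : (1 : ℚ) < (n : ℚ) ^ l k₀ := one_lt_pow₀ (by exact_mod_cast hn) hk₀
    linarith
  have hz0 : 0 ≤ A k₀ := by
    by_contra! hneg
    have e := hA (h0 _ hneg.le)
    have : (0 : ℚ) ≤ k₀ := by exact_mod_cast hk0
    linarith
  set j := ⌊A k₀⌋₊ with hj
  have hj0 : (j : ℚ) ≤ A k₀ := Nat.floor_le hz0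
  have hj1 : A k₀ < j + 1 := Nat.lt_floor_add_one _
  have hne : ∀ k, ¬ (l k = 0 ∧ b k = j) := fun k ⟨h1, h2⟩ => by
    have e := h k (A k₀ - j) (by linarith) (by linarith)
    rw [h1, h2, pow_zero, div_one, div_one, Int.cast_natCast, add_sub_cancel] at e
    have e' := hA e
    have h3 : (k : ℚ) ≤ k₀ := by linarith
    have h4 : (k₀ : ℚ) < k + 1 := by linarith
    have h5 : k ≤ k₀ := by exact_mod_cast h3
    have h6 : k₀ < k + 1 := by exact_mod_cast h4
    obtain rfl : k = k₀ := by omega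
    exact hk₀ h1
  choose c r hcr hle hlt using fun k => exists_mapsAdic_expand (hn := hn) (b k) (l k) (hne k)
  have hk₀s : k₀ ∈ s := by
    by_contra hmem
    exact hk₀ (hs _ hmem)
  have hlt' : r k₀ < l k₀ := by
    apply hlt <;> rw [← hl] <;> assumption
  obtain ⟨γ, hγ, hγA⟩ := ih (∑ k ∈ s, r k)
    (hS ▸ Finset.sum_lt_sum (fun k _ => hle k) ⟨k₀, hk₀s, hlt'⟩)
    (A := expand n hn j ∘ A) ((expand n hn j).injective.comp hA)
    (fun x hx => by
      rw [Function.comp_apply, h0 x hx, expand_of_le (hx.trans (by positivity))])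
    (fun k => (hcr k).comp (h k)) (fun k hk => Nat.eq_zero_of_le_zero (hs k hk ▸ hle k)) rfl
  exact ⟨γ * expand n hn j, mul_mem hγ (Subgroup.subset_closure ⟨j, rfl⟩), hγA⟩

/-- The injection of the line into `(-∞, 1)` that maps the unit intervals in `[0, n ^ N - 1]` onto
the `n`-adic intervals of level `N`, and the later ones onto the images of unit intervals under
the chart. -/
def gridChart (n N : ℕ) (x : ℚ) : ℚ :=
  if x ≤ 0 then x else
    if x ≤ (n : ℚ) ^ N - 1 then x / (n : ℚ) ^ N
    else 1 - (1 - chart n (x - ((n : ℚ) ^ N - 1))) / (n : ℚ) ^ N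

section gridChart

variable {N : ℕ} {x : ℚ}

lemma gridChart_of_nonpos (hx : x ≤ 0) : gridChart n N x = x := if_pos hx

lemma gridChart_of_mem (hx : 0 ≤ x) (hx' : x ≤ (n : ℚ) ^ N - 1) :
    gridChart n N x = x / (n : ℚ) ^ N := by
  rcases hx.eq_or_lt with rfl | hx
  · simp [gridChart_of_nonpos le_rfl]
  · rw [gridChart, if_neg hx.not_ge, if_pos hx']

lemma gridChart_of_ge (hn : 2 ≤ n) (hx : (n : ℚ) ^ N - 1 ≤ x) :
    gridChart n N x = 1 - (1 - chart n (x - ((n : ℚ) ^ N - 1))) / (n : ℚ) ^ N := by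
  have h1 : (1 : ℚ) ≤ (n : ℚ) ^ N := one_le_pow₀ (by exact_mod_cast (by omega : 1 ≤ n))
  rcases hx.eq_or_lt with rfl | hx
  · rw [gridChart_of_mem (by linarith) le_rfl, sub_self, chart_of_nonpos le_rfl]
    field_simp
    ring
  · rw [gridChart, if_neg (by linarith), if_neg hx.not_ge]

lemma gridChart_lt_one (hn : 2 ≤ n) : gridChart n N x < 1 := by
  have h1 : (0 : ℚ) < (n : ℚ) ^ N := by positivity
  rcases le_total x 0 with h | h
  · rw [gridChart_of_nonpos h]; linarith
  rcases le_total x ((n : ℚ) ^ N - 1) with h' | h'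
  · rw [gridChart_of_mem h h', div_lt_one h1]; linarith
  · rw [gridChart_of_ge hn h', sub_lt_self_iff]
    exact div_pos (sub_pos.2 (chart_lt_one hn)) h1

lemma gridChart_injective (hn : 2 ≤ n) : Function.Injective (gridChart n N) := by
  have h1 : (0 : ℚ) < (n : ℚ) ^ N := by positivity
  refine StrictMono.injective fun x y hxy => ?_
  have hpos : ∀ z, 0 < z → 0 < gridChart n N z := fun z hz => by
    rcases le_total z ((n : ℚ) ^ N - 1) with h' | h'
    · rw [gridChart_of_mem hz.le h']; positivity
    · rw [gridChart_of_ge hn h', sub_pos, div_lt_one h1]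
      have h2 := chart_nonneg hn (sub_nonneg.2 h')
      rcases h'.lt_or_eq with h' | h'
      · have h3 := chart_strictMono hn (sub_pos.2 h')
        rw [chart_of_nonpos le_rfl] at h3
        have h4 : (1 : ℚ) ≤ (n : ℚ) ^ N := one_le_pow₀ (by exact_mod_cast (by omega : 1 ≤ n))
        linarith
      · linarith
  rcases le_or_gt x 0 with hx | hx
  · rw [gridChart_of_nonpos hx]
    rcases le_or_gt y 0 with hy | hy
    · rwa [gridChart_of_nonpos hy]
    · exact hx.trans_lt (hpos y hy)
  rcases le_or_gt y ((n : ℚ) ^ N - 1) with hy | hy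
  · rw [gridChart_of_mem hx.le (hxy.le.trans hy), gridChart_of_mem (hx.trans hxy).le hy]
    gcongr
  rw [gridChart_of_ge hn hy.le]
  rcases le_or_gt x ((n : ℚ) ^ N - 1) with hx' | hx'
  · have h3 := chart_strictMono hn (sub_pos.2 hy)
    rw [chart_of_nonpos le_rfl] at h3
    rw [gridChart_of_mem hx.le hx', lt_sub_iff_add_lt, ← add_div, div_lt_one h1]
    linarith
  · have h3 := chart_strictMono hn (sub_lt_sub_right hxy ((n : ℚ) ^ N - 1))
    rw [gridChart_of_ge hn hx'.le]
    gcongr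

end gridChart

lemma exists_mem_closure_expand_gridChart (hn : 2 ≤ n) {f g : Equiv.Perm ℚ} {N : ℕ}
    (f0 : ∀ x ≤ 0, f x = x) (f1 : ∀ x, 1 ≤ x → f x = x)
    (hf : ∀ a, ∃ b l, MapsAdic n f a N b l) (hg : chartHom n hn g = f) {D : ℚ → ℚ}
    (hD : ∀ x, chart n (D x) = gridChart n N x) :
    ∃ γ ∈ Subgroup.closure (Set.range (expand n hn)), ∀ x, γ (g (D x)) = x := by
  have hN : (0 : ℚ) < (n : ℚ) ^ N := by positivity
  have hc := (chart_strictMono hn).injective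
  have hA : ∀ x, chart n (g (D x)) = f (gridChart n N x) := fun x => by
    rw [← chartHom_apply_chart hn, hg, hD]
  have hA0 : ∀ x ≤ 0, g (D x) = x := fun x hx => hc <| by
    rw [hA, gridChart_of_nonpos hx, f0 x hx, chart_of_nonpos hx]
  have key : ∀ k : ℤ, ∃ b l, MapsAdic n (g ∘ D) k 0 b l ∧
      (k ∉ Finset.Ico (0 : ℤ) (n ^ N - 1) → l = 0) := fun k => by
    rcases lt_or_ge k 0 with hk | hk
    · exact ⟨k, 0, .id_of_nonpos hn hA0 hk, fun _ => rfl⟩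
    have hk' : (0 : ℚ) ≤ k := by exact_mod_cast hk
    rcases lt_or_ge (k + 1) ((n : ℤ) ^ N) with hkN | hkN
    · have hkN' : (k : ℚ) + 1 + 1 ≤ (n : ℚ) ^ N := by exact_mod_cast hkN
      obtain ⟨b, l, hb⟩ := hf k
      have hl : (0 : ℚ) < (n : ℚ) ^ l := by positivity
      have hb0 : 0 ≤ b := by
        by_contra! hneg
        have hneg' : (b : ℚ) < 0 := by exact_mod_cast hneg
        have e := hb.left
        have h2 : (b : ℚ) / (n : ℚ) ^ l < 0 := div_neg_of_neg_of_pos hneg' hl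
        rw [← f0 _ h2.le] at e
        have h3 : 0 ≤ (k : ℚ) / (n : ℚ) ^ N := by positivity
        rw [f.injective e] at h3
        linarith
      have hb1 : b + 1 < (n : ℤ) ^ l := by
        have h2 : f ((k + 1) / (n : ℚ) ^ N) < 1 := by
          rw [perm_lt_one_iff f1, div_lt_one hN]
          linarith
        rw [hb.right, div_lt_one hl] at h2
        exact_mod_cast h2
      obtain ⟨c, r, -, hcr, -⟩ := exists_chart_mapsAdic hn hb0 hb1
      refine ⟨c, r, fun t h0 h1 => hc ?_, fun hmem => ?_⟩
      · rw [Function.comp_apply, hA, hcr t h0 h1, pow_zero, div_one,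
          gridChart_of_mem (by linarith) (by linarith), hb t h0 h1]
      · exact absurd (Finset.mem_Ico.2 ⟨hk, by omega⟩) hmem
    · have hkN' : (n : ℚ) ^ N ≤ k + 1 := by exact_mod_cast hkN
      obtain ⟨b, l, hb⟩ := hf (n ^ N - 1)
      have hl : (0 : ℚ) < (n : ℚ) ^ l := by positivity
      have hbl : (b : ℚ) + 1 = (n : ℚ) ^ l := by
        have e := hb.right
        push_cast at e
        rw [sub_add_cancel, div_self hN.ne', f1 1 le_rfl, eq_div_iff hl.ne'] at e
        linarith
      refine ⟨k - (n ^ N - 1) + (n - 1) * l, 0, fun t h0 h1 => hc ?_, fun _ => rfl⟩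
      have hz : 0 ≤ k + t - ((n : ℚ) ^ N - 1) := by linarith
      have e1 : 1 - (1 - chart n (k + t - ((n : ℚ) ^ N - 1))) / (n : ℚ) ^ N
          = (((n ^ N - 1 : ℤ) : ℚ) + chart n (k + t - ((n : ℚ) ^ N - 1))) / (n : ℚ) ^ N := by
        push_cast
        field_simp
        ring
      rw [Function.comp_apply, hA, pow_zero, div_one, div_one, gridChart_of_ge hn (by linarith),
        e1, hb _ (chart_nonneg hn hz) (chart_lt_one hn).le, eq_sub_of_add_eq hbl]
      have e2 : (((k - (n ^ N - 1) + (n - 1) * l : ℤ) : ℚ) + t)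
          = k + t - ((n : ℚ) ^ N - 1) + (n - 1) * l := by
        push_cast
        ring
      rw [e2, chart_add hn hz]
      field_simp
      ring
  choose b l hbl hl0 using key
  refine exists_mem_closure_expand_comp_eq hn (Finset.Ico (0 : ℤ) (n ^ N - 1)) (A := g ∘ D)
    (fun x y hxy => ?_) hA0 hbl hl0
  have := congrArg (chart n) hxy
  simp only [Function.comp_apply, hA] at this
  exact gridChart_injective hn (f.injective this)

/-- `plGroup n` is generated by the conjugates of the expansions. -/
lemma plGroup_eq_map_closure (hn : 2 ≤ n) :
    plGroup n hn = (Subgroup.closure (Set.range (expand n hn))).map (chartHom n hn) := by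
  apply le_antisymm
  · rintro f ⟨f0, f1, N, hf⟩
    obtain ⟨g, hg⟩ := exists_chartHom_eq hn f1
    choose D hD using fun x => exists_chart_eq hn (gridChart_lt_one (N := N) (x := x) hn)
    obtain ⟨γ, hγ, h1⟩ := exists_mem_closure_expand_gridChart hn f0 f1 hf hg hD
    obtain ⟨δ, hδ, h2⟩ := exists_mem_closure_expand_gridChart hn (f := 1) (g := 1) (N := N)
      (fun _ _ => rfl) (fun _ _ => rfl) (fun a => ⟨a, N, fun _ _ _ => rfl⟩) (map_one _) hD
    refine ⟨g, ?_, hg⟩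
    have : g = γ⁻¹ * δ := by
      ext x
      rw [Equiv.Perm.mul_apply, Equiv.Perm.eq_inv_iff_eq]
      have hx : D (δ x) = x := δ.injective (h2 (δ x))
      have := h1 (δ x)
      rwa [hx] at this
    rw [this]
    exact mul_mem (inv_mem hγ) hδ
  · rw [Subgroup.map_le_iff_le_comap, Subgroup.closure_le]
    rintro _ ⟨i, rfl⟩
    exact chartHom_expand_mem hn i

end generation

lemma plGroup_two_eq_thompsonF : plGroup 2 le_rfl = thompsonF := by
  apply le_antisymm
  · rw [plGroup_eq_map_closure, Subgroup.map_le_iff_le_comap, Subgroup.closure_le]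
    have h0 : chartHom 2 le_rfl (expand 2 le_rfl 0) ∈ thompsonF :=
      Subgroup.subset_closure (Or.inl coe_chartHom_expand_zero)
    rintro _ ⟨i, rfl⟩
    change chartHom 2 le_rfl (expand 2 le_rfl i) ∈ thompsonF
    induction i with
    | zero => exact h0
    | succ i ih =>
      rcases i.eq_zero_or_pos with rfl | hi
      · exact Subgroup.subset_closure (Or.inr coe_chartHom_expand_one)
      · have := expand_mul_expand (n := 2) (hn := le_rfl) hi
        rw [show i + 2 - 1 = i + 1 by omega] at this
        rw [eq_mul_inv_of_mul_eq this, map_mul, map_mul, map_inv]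
        exact mul_mem (mul_mem h0 ih) (inv_mem h0)
  · rw [thompsonF, Subgroup.closure_le]
    rintro g (hg | hg)
    · rw [← coe_chartHom_expand_zero] at hg
      rw [DFunLike.coe_injective hg]
      exact chartHom_expand_mem le_rfl 0
    · rw [← coe_chartHom_expand_one] at hg
      rw [DFunLike.coe_injective hg]
      exact chartHom_expand_mem le_rfl 1

section coloring

variable {p : ℕ}

lemma two_mul_inv_zmod (hodd : Odd p) : (2 : ZMod p) * 2⁻¹ = 1 := by
  have := ZMod.coe_mul_inv_eq_one (n := p) 2 (Nat.coprime_two_left.2 hodd)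
  exact_mod_cast this

lemma isDyadic_intCast_div (a : ℤ) (m : ℕ) : IsDyadic (a / (2 : ℚ) ^ m) := by
  have h : (((a / (2 : ℚ) ^ m).den : ℕ) : ℤ) ∣ ((2 ^ m : ℕ) : ℤ) := by
    have := Rat.den_dvd a (2 ^ m)
    rw [Rat.divInt_eq_div] at this
    push_cast at this ⊢
    exact this
  obtain ⟨k, -, hk⟩ := (Nat.dvd_prime_pow Nat.prime_two).1 (Int.natCast_dvd_natCast.1 h)
  exact ⟨k, hk⟩

lemma IsDyadic.exists_eq {x : ℚ} (hx : IsDyadic x) : ∃ (a : ℤ) (m : ℕ), x = a / (2 : ℚ) ^ m := by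
  obtain ⟨m, hm⟩ := hx
  refine ⟨x.num, m, ?_⟩
  conv_lhs => rw [← Rat.num_div_den x, hm]
  push_cast
  rfl

lemma piP_intCast_div (hodd : Odd p) (a : ℤ) (m : ℕ) :
    piP p (a / (2 : ℚ) ^ m) = a * (2⁻¹ : ZMod p) ^ m := by
  obtain ⟨k, hk⟩ := isDyadic_intCast_div a m
  rw [piP, hk, padicValNat.prime_pow]
  set x := a / (2 : ℚ) ^ m with hx
  have h1 : (x.num : ℚ) / (2 : ℚ) ^ k = a / (2 : ℚ) ^ m := by
    rw [← hx]
    conv_rhs => rw [← Rat.num_div_den x, hk]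
    push_cast
    rfl
  have h2 : x.num * 2 ^ m = a * 2 ^ k := by
    rw [div_eq_div_iff (by positivity) (by positivity)] at h1
    exact_mod_cast h1
  have h3 : (x.num : ZMod p) * 2 ^ m = a * 2 ^ k := by
    exact_mod_cast congrArg (Int.cast (R := ZMod p)) h2
  have e : ∀ j, (2 : ZMod p) ^ j * 2⁻¹ ^ j = 1 := fun j => by
    rw [← mul_pow, two_mul_inv_zmod hodd, one_pow]
  calc (x.num : ZMod p) * 2⁻¹ ^ k = (x.num * 2 ^ m) * 2⁻¹ ^ m * 2⁻¹ ^ k := by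
        rw [mul_assoc (x.num : ZMod p), e, mul_one]
    _ = a * 2⁻¹ ^ m * (2 ^ k * 2⁻¹ ^ k) := by rw [h3]; ring
    _ = a * 2⁻¹ ^ m := by rw [e, mul_one]

lemma orderOf_two_pos (hodd : Odd p) : 0 < orderOf (2 : ZMod p) := by
  have : NeZero p := ⟨hodd.pos.ne'⟩
  have h := orderOf_pos (ZMod.unitOfCoprime 2 (Nat.coprime_two_left.2 hodd))
  rw [← orderOf_units, ZMod.coe_unitOfCoprime] at h
  exact_mod_cast h

lemma two_le_two_pow_orderOf (hodd : Odd p) : 2 ≤ 2 ^ orderOf (2 : ZMod p) :=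
  Nat.le_self_pow (orderOf_two_pos hodd).ne' 2

lemma mapsAdic_two_pow {q m l : ℕ} {g : ℚ → ℚ} {a b : ℤ} :
    MapsAdic (2 ^ q) g a m b l ↔ MapsAdic 2 g a (q * m) b (q * l) := by
  simp only [MapsAdic, Nat.cast_pow, Nat.cast_ofNat, pow_mul]

lemma piP_div_pow_orderOf (hodd : Odd p) (a : ℤ) (m : ℕ) :
    piP p (a / ((2 ^ orderOf (2 : ZMod p) : ℕ) : ℚ) ^ m) = a := by
  have h : (2⁻¹ : ZMod p) ^ orderOf (2 : ZMod p) = 1 := by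
    have := congrArg (· ^ orderOf (2 : ZMod p)) (two_mul_inv_zmod hodd)
    simpa [mul_pow, pow_orderOf_eq_one] using this
  rw [Nat.cast_pow, Nat.cast_ofNat, ← pow_mul, piP_intCast_div hodd, pow_mul, h, one_pow, mul_one]

lemma piP_apply_of_mem_plGroup (hodd : Odd p) {f : Equiv.Perm ℚ}
    (hf : f ∈ plGroup (2 ^ orderOf (2 : ZMod p)) (two_le_two_pow_orderOf hodd)) {x : ℚ}
    (hx : IsDyadic x) (h0 : 0 < x) : piP p (f x) = piP p x := by
  obtain ⟨f0, -, N, hN⟩ := hf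
  set q := orderOf (2 : ZMod p) with hq
  have hn : 2 ≤ 2 ^ q := two_le_two_pow_orderOf hodd
  obtain ⟨c, s, rfl⟩ := hx.exists_eq
  choose b l hb using MapsAdic.exists_refine hn hN s
  have hcol : ∀ a : ℕ, (b a : ZMod p) = a := fun a => by
    induction a with
    | zero =>
      have h := (hb 0).left
      rw [Int.cast_zero, zero_div, f0 0 le_rfl, eq_comm, div_eq_zero_iff] at h
      have : b 0 = 0 := by exact_mod_cast h.resolve_right (by positivity)
      simp [this]
    | succ a ih =>
      have h1 := (hb a).right
      have h2 := (hb (a + 1 : ℕ)).left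
      push_cast at h1 h2
      have h3 := congrArg (piP p) (h1.symm.trans h2)
      have h4 := piP_div_pow_orderOf hodd (b a + 1) (l a + s)
      have h5 := piP_div_pow_orderOf hodd (b (a + 1)) (l (a + 1) + s)
      push_cast at h4 h5 ⊢
      rw [← h5, ← h3, h4, ih]
  have hsle : s ≤ q * (N + s) := by
    have := orderOf_two_pos hodd
    nlinarith
  obtain ⟨e, he⟩ := Nat.exists_eq_add_of_le hsle
  have hc0 : 0 ≤ c * 2 ^ e := by
    rw [lt_div_iff₀ (by positivity), zero_mul] at h0
    have : 0 < c := by exact_mod_cast h0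
    positivity
  obtain ⟨a, ha⟩ := Int.eq_ofNat_of_zero_le hc0
  have hx' : c / (2 : ℚ) ^ s = (a : ℤ) / ((2 ^ q : ℕ) : ℚ) ^ (N + s) := by
    rw [← ha, Nat.cast_pow, Nat.cast_ofNat, ← pow_mul, he, pow_add]
    push_cast
    field_simp
  rw [hx', (hb a).left, piP_div_pow_orderOf hodd, piP_div_pow_orderOf hodd, hcol, Int.cast_natCast]

lemma orderOf_two_dvd_of_mapsAdic (hodd : Odd p) {f : Equiv.Perm ℚ}
    (hf : ∀ x : ℚ, IsDyadic x → 0 < x → x < 1 → piP p (f x) = piP p x) {a b : ℤ} {m l : ℕ}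
    (ha : 0 ≤ a) (ha' : a < 2 ^ (orderOf (2 : ZMod p) * m))
    (h : MapsAdic 2 f a (orderOf (2 : ZMod p) * m) b l) : orderOf (2 : ZMod p) ∣ l := by
  set q := orderOf (2 : ZMod p) with hq
  have e : ∀ (c : ℤ) (k i : ℕ), (c + (i / 4 : ℚ)) / ((2 : ℕ) : ℚ) ^ k
      = ((4 * c + i : ℤ) : ℚ) / (2 : ℚ) ^ (k + 2) := fun c k i => by
    push_cast
    rw [pow_add]
    field_simp
    ring
  have key : ∀ i : ℕ, 0 < i → i < 4 → ((4 * b + i : ℤ) : ZMod p) * 2⁻¹ ^ (l + 2)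
      = ((4 * a + i : ℤ) : ZMod p) * 2⁻¹ ^ (q * m + 2) := fun i hi0 hi4 => by
    have hi0' : (0 : ℚ) < i := by exact_mod_cast hi0
    have hi4' : (i : ℚ) < 4 := by exact_mod_cast hi4
    have h1 := h (i / 4) (by positivity) (by linarith)
    rw [e, e] at h1
    rw [← piP_intCast_div hodd, ← piP_intCast_div hodd, ← h1]
    have ha0 : (0 : ℚ) ≤ a := by exact_mod_cast ha
    have ha1 : (a : ℚ) + 1 ≤ (2 : ℚ) ^ (q * m) := by exact_mod_cast ha'
    refine hf _ (isDyadic_intCast_div _ _) ?_ ?_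
    · push_cast; positivity
    · rw [div_lt_one (by positivity), pow_add]
      push_cast
      linarith
  have k1 := key 1 (by norm_num) (by norm_num)
  have k2 := key 2 (by norm_num) (by norm_num)
  push_cast at k1 k2
  have k3 : (2⁻¹ : ZMod p) ^ (l + 2) = 2⁻¹ ^ (q * m + 2) := by linear_combination k2 - k1
  have e2 : ∀ j, (2 : ZMod p) ^ j * 2⁻¹ ^ j = 1 := fun j => by
    rw [← mul_pow, two_mul_inv_zmod hodd, one_pow]
  rw [hq, orderOf_dvd_iff_pow_eq_one]
  have hqm : (2 : ZMod p) ^ (q * m) = 1 := by rw [pow_mul, hq, pow_orderOf_eq_one, one_pow]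
  calc (2 : ZMod p) ^ l = 2 ^ l * (2 ^ (q * m + 2) * 2⁻¹ ^ (q * m + 2)) := by rw [e2, mul_one]
    _ = 2 ^ (q * m) * (2 ^ (l + 2) * 2⁻¹ ^ (l + 2)) := by rw [← k3]; ring
    _ = 1 := by rw [e2, hqm, mul_one]

/-- The `p`-colorable subgroup of Thompson's group consists of the piecewise affine maps over the
base `2 ^ q`, where `q` is the order of `2` modulo `p`. -/
lemma mem_plGroup_two_pow_orderOf_iff (hodd : Odd p) (f : Equiv.Perm ℚ) :
    f ∈ plGroup (2 ^ orderOf (2 : ZMod p)) (two_le_two_pow_orderOf hodd) ↔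
      f ∈ thompsonF ∧ ∀ x : ℚ, IsDyadic x → 0 < x → x < 1 → piP p (f x) = piP p x := by
  rw [← plGroup_two_eq_thompsonF]
  constructor
  · intro hf
    refine ⟨?_, fun x hx h0 _ => piP_apply_of_mem_plGroup hodd hf hx h0⟩
    obtain ⟨f0, f1, N, hN⟩ := hf
    exact ⟨f0, f1, orderOf (2 : ZMod p) * N, fun a =>
      let ⟨b, l, h⟩ := hN a
      ⟨b, _, mapsAdic_two_pow.1 h⟩⟩
  · rintro ⟨⟨f0, f1, N, hN⟩, hcol⟩
    refine ⟨f0, f1, N, fun a => ?_⟩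
    rcases lt_or_ge a 0 with ha | ha
    · exact ⟨a, N, .id_of_nonpos (two_le_two_pow_orderOf hodd) f0 ha⟩
    rcases le_or_gt (((2 ^ orderOf (2 : ZMod p) : ℕ) : ℤ) ^ N) a with ha' | ha'
    · exact ⟨a, N, .id_of_one_le (two_le_two_pow_orderOf hodd) f1 ha'⟩
    rw [Nat.cast_pow, Nat.cast_ofNat, ← pow_mul] at ha'
    obtain ⟨d, hd⟩ : ∃ d, orderOf (2 : ZMod p) * N = N + d :=
      Nat.exists_eq_add_of_le (Nat.le_mul_of_pos_left N (orderOf_two_pos hodd))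
    obtain ⟨b, l, h⟩ := MapsAdic.exists_refine le_rfl hN d a
    rw [← hd] at h
    obtain ⟨r, hr⟩ := orderOf_two_dvd_of_mapsAdic hodd hcol ha ha' h
    exact ⟨b, r, mapsAdic_two_pow.2 (hr ▸ h)⟩

end coloring

lemma range_lineAction {n : ℕ} (hn : 2 ≤ n) :
    (lineAction n hn).range = Subgroup.closure (Set.range (expand n hn)) := by
  rw [MonoidHom.range_eq_map, ← PresentedGroup.closure_range_of, MonoidHom.map_closure,
    ← Set.range_comp, ← Subgroup.closure_inv]
  congr 1
  ext g
  simp [lineAction_of]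

/-- Let `p ≥ 3` be odd and `q` the multiplicative order of `2` modulo `p`.  The
`p`-colorable subgroup `H = {f ∈ G : π_p(f(x)) = π_p(x) for all dyadic x ∈ (0,1)}` of
Thompson's group `G` is isomorphic to the Brown–Thompson group `F(2^q)`: there is an
injective group homomorphism from `F(2^q)` (given by its presentation) into `Equiv.Perm ℚ`
whose range is exactly `H`. -/
theorem pColorable_iso_brownThompson (p : ℕ) (hp3 : 3 ≤ p) (hodd : Odd p) :
    ∃ φ : PresentedGroup (brownThompsonRels (2 ^ orderOf (2 : ZMod p))) →* Equiv.Perm ℚ,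
      Function.Injective ⇑φ ∧
      Set.range ⇑φ =
        {f : Equiv.Perm ℚ | f ∈ thompsonF ∧
          ∀ x : ℚ, IsDyadic x → 0 < x → x < 1 → piP p (f x) = piP p x} := by
  have hn := two_le_two_pow_orderOf hodd
  refine ⟨(chartHom _ hn).comp (lineAction _ hn),
    (Equiv.Perm.extendDomainHom_injective _).comp (lineAction_injective hn), ?_⟩
  rw [← MonoidHom.coe_range, MonoidHom.range_comp, range_lineAction, ← plGroup_eq_map_closure]
  ext f
  exact mem_plGroup_two_pow_orderOf_iff hodd f
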